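/- arXiv:2010.10460 — 2 statements merged into one kernel-verified Lean document; each statement's English description precedes it below -/
import Mathlib

section
/- Define Λ(ξ) := ξ₃/‖ξ‖ for ξ ≠ 0, write ξ_h := (ξ₁,ξ₂,0), σ̄(ξ,η) := ξ₃η_h − η₃ξ_h, and set F(ξ,η) := σ̄(ξ,η)·(ξ_h−η_h)/‖ξ−η‖³ (so F = S_η Φ, the scaling vector field applied to the phase). Let ξ, η ∈ ℝ³ with ξ ≠ η. Then the map η' ↦ F(ξ,η') is differentiable at η and its directional derivative at η in the direction η satisfies η·∇_η F(ξ,η) = F(ξ,η)·( 3·(η·(ξ−η))/‖ξ−η‖² + 2 ) − σ̄(ξ,η)·ξ_h/‖ξ−η‖³. -/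
open MeasureTheory RealInnerProductSpace

noncomputable section

/-- Euclidean 3-space. -/
abbrev E3 : Type := EuclideanSpace ℝ (Fin 3)

/-- The vector `(a, b, c) ∈ ℝ³`. -/
def Ev3 (a b c : ℝ) : E3 := (WithLp.equiv 2 (Fin 3 → ℝ)).symm ![a, b, c]

/-- Horizontal part `v_h = (v₁, v₂, 0)` of a vector `v ∈ ℝ³`. -/
def hpart (v : E3) : E3 := Ev3 (v 0) (v 1) 0

/-- Horizontal rotation by 90 degrees: `v_h^⊥ = (−v₂, v₁, 0)`. -/
def hperp (v : E3) : E3 := Ev3 (-(v 1)) (v 0) 0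

/-- The quantity `σ̄(ξ,η) := ξ₃ η_h − η₃ ξ_h`. -/
def sigmaBar (ξ η : E3) : E3 := (ξ 2) • hpart η - (η 2) • hpart ξ

/-- The dispersion relation `Λ(ξ) = ξ₃ / ‖ξ‖`. -/
def Lam (ξ : E3) : ℝ := ξ 2 / ‖ξ‖

/-- `s(ξ) := √(1 − Λ(ξ)²)`. -/
def sfun (ξ : E3) : ℝ := Real.sqrt (1 - Lam ξ ^ 2)

/-- The vertical unit vector `e₃`. -/
def e₃ : E3 := Ev3 0 0 1

/-- The direction `w(ξ) = (Λ(ξ)/s(ξ)) ξ_h − ‖ξ‖ s(ξ) e₃` of the vector field `Υ = ∂_φ`. -/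
def wvec (ξ : E3) : E3 := (Lam ξ / sfun ξ) • hpart ξ - (‖ξ‖ * sfun ξ) • e₃

/-- `F(ξ,η) = S_ηΦ = σ̄(ξ,η)·(ξ_h−η_h)/‖ξ−η‖³`, the scaling vector field applied to the phase. -/
def Ffun (ξ η : E3) : ℝ := ⟪sigmaBar ξ η, hpart ξ - hpart η⟫ / ‖ξ - η‖ ^ 3

/-- The horizontal projection as a continuous linear map. -/
def hpartCLM : E3 →L[ℝ] E3 :=
  LinearMap.toContinuousLinearMap
    { toFun := hpart
      map_add' := fun v w => by ext i; fin_cases i <;> simp [hpart, Ev3]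
      map_smul' := fun c v => by ext i; fin_cases i <;> simp [hpart, Ev3] }

theorem hasFDerivAt_hpart (v : E3) : HasFDerivAt hpart hpartCLM v :=
  hpartCLM.hasFDerivAt

theorem hasFDerivAt_sigmaBar (ξ η : E3) :
    HasFDerivAt (sigmaBar ξ)
      (ξ 2 • hpartCLM - (EuclideanSpace.proj (2 : Fin 3) : E3 →L[ℝ] ℝ).smulRight (hpart ξ)) η :=
  ((hasFDerivAt_hpart η).const_smul (ξ 2)).sub
    ((EuclideanSpace.proj (2 : Fin 3) : E3 →L[ℝ] ℝ).hasFDerivAt.smul_const (hpart ξ))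

theorem hasFDerivAt_norm_of_ne_zero {E : Type*} [NormedAddCommGroup E] [InnerProductSpace ℝ E]
    {x : E} (hx : x ≠ 0) : HasFDerivAt (fun y : E => ‖y‖) (‖x‖⁻¹ • innerSL ℝ x) x := by
  have h := (hasStrictFDerivAt_norm_sq x).hasFDerivAt.sqrt (pow_ne_zero 2 (norm_ne_zero_iff.2 hx))
  simp only [Real.sqrt_sq (norm_nonneg _)] at h
  convert h using 1
  ext v
  simp
  ring

/-- **Second-order formula `S_η²Φ = S_ηΦ[3 η·(ξ−η)/‖ξ−η‖² + 2] − σ̄·ξ_h/‖ξ−η‖³`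
(Lemma A.1, equation (A.4)).** -/
theorem stmt_16 (ξ η : E3) (hne : ξ ≠ η) :
    DifferentiableAt ℝ (fun η' : E3 => Ffun ξ η') η ∧
    fderiv ℝ (fun η' : E3 => Ffun ξ η') η η
      = Ffun ξ η * (3 * ⟪η, ξ - η⟫ / ‖ξ - η‖ ^ 2 + 2)
        - ⟪sigmaBar ξ η, hpart ξ⟫ / ‖ξ - η‖ ^ 3 := by
  have hr : ‖ξ - η‖ ≠ 0 := norm_ne_zero_iff.2 (sub_ne_zero.2 hne)
  have hN := (hasFDerivAt_sigmaBar ξ η).inner ℝ ((hasFDerivAt_hpart η).const_sub (hpart ξ))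
  have hD := ((hasFDerivAt_norm_of_ne_zero (sub_ne_zero.2 hne)).comp η
    ((hasFDerivAt_id η).const_sub ξ)).pow 3
  have hF : HasFDerivAt (fun η' : E3 => Ffun ξ η') _ η :=
    (hN.mul ((hasDerivAt_inv (pow_ne_zero 3 hr)).comp_hasFDerivAt η hD)).congr_of_eventuallyEq
      (.of_forall fun η' => div_eq_mul_inv _ _)
  refine ⟨hF.differentiableAt, ?_⟩
  have hL : hpartCLM η = hpart η := rfl
  have hS : ξ 2 • hpart η - η 2 • hpart ξ = sigmaBar ξ η := rfl
  rw [hF.fderiv]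
  simp [hL, hS, Ffun, inner_sub_right, real_inner_comm η]
  field_simp
  ring
end
end

section
/- Define Λ(ξ) := ξ₃/‖ξ‖ for ξ ≠ 0, write ξ_h := (ξ₁,ξ₂,0), s(ξ) := √(1−Λ(ξ)²) = ‖ξ_h‖/‖ξ‖, and for ζ with ζ_h ≠ 0 let w(ζ) := (Λ(ζ)/s(ζ))·ζ_h − ‖ζ‖·s(ζ)·e₃. Let f : ℝ³ → ℝ, let ξ, η ∈ ℝ³ with η_h ≠ 0 and (ξ−η)_h ≠ 0, set ζ := ξ−η and ω_c := (η_h·ζ_h)/(‖η_h‖·‖ζ_h‖), and assume f is differentiable at ζ with ζ_h^⊥·∇f(ζ) = 0 (axisymmetry at ζ, i.e. Ωf(ζ) = 0). Then η·∇f(ζ) = (‖η‖/‖ζ‖)·[ ω_c·s(η)·s(ζ) + Λ(η)·Λ(ζ) ]·( ζ·∇f(ζ) ) + (‖η‖/‖ζ‖)·[ ω_c·s(η)·Λ(ζ) − Λ(η)·s(ζ) ]·( w(ζ)·∇f(ζ) ). -/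
open MeasureTheory RealInnerProductSpace

noncomputable section

@[simp] lemma Ev3_apply_zero (a b c : ℝ) : Ev3 a b c 0 = a := rfl

@[simp] lemma Ev3_apply_one (a b c : ℝ) : Ev3 a b c 1 = b := rfl

@[simp] lemma Ev3_apply_two (a b c : ℝ) : Ev3 a b c 2 = c := rfl

lemma norm_sq_eq_norm_hpart_sq_add (v : E3) : ‖v‖ ^ 2 = ‖hpart v‖ ^ 2 + v 2 ^ 2 := by
  simp [EuclideanSpace.norm_sq_eq, Fin.sum_univ_three, hpart]

lemma norm_pos_of_hpart_ne_zero {v : E3} (hv : hpart v ≠ 0) : 0 < ‖v‖ := by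
  have h : 0 < ‖hpart v‖ := norm_pos_iff.mpr hv
  have := norm_sq_eq_norm_hpart_sq_add v
  exact (norm_nonneg v).lt_of_ne fun h0 => by
    rw [← h0] at this
    nlinarith [sq_nonneg (v 2)]

lemma sfun_eq_div {v : E3} (hv : hpart v ≠ 0) : sfun v = ‖hpart v‖ / ‖v‖ := by
  have hpos := norm_pos_of_hpart_ne_zero hv
  have h : 1 - Lam v ^ 2 = (‖hpart v‖ / ‖v‖) ^ 2 := by
    unfold Lam
    field_simp
    linarith [norm_sq_eq_norm_hpart_sq_add v]
  rw [sfun, h, Real.sqrt_sq (by positivity)]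

lemma wvec_eq {v : E3} (hv : hpart v ≠ 0) :
    wvec v = (v 2 / ‖hpart v‖) • hpart v - ‖hpart v‖ • e₃ := by
  have hpos := norm_pos_of_hpart_ne_zero hv
  rw [wvec, sfun_eq_div hv, Lam, div_div_div_cancel_right₀ hpos.ne', mul_div_cancel₀ _ hpos.ne']

lemma eq_hpart_add_smul_e₃ (v : E3) : v = hpart v + v 2 • e₃ := by
  ext i
  fin_cases i <;> simp [hpart, e₃]

lemma norm_hpart_sq_smul_hpart (u v : E3) :
    ‖hpart v‖ ^ 2 • hpart u
      = ⟪hpart u, hpart v⟫ • hpart v + ⟪hpart u, hperp v⟫ • hperp v := by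
  ext i
  fin_cases i <;>
    simp [EuclideanSpace.norm_sq_eq, Fin.sum_univ_three, PiLp.inner_apply, hpart, hperp] <;> ring

/-- **Vector-field cross term `S_η` on axisymmetric functions (Lemma 6.4).**
Writing `ζ = ξ − η` and `ω_c = (η_h·ζ_h)/(‖η_h‖‖ζ_h‖)`, if `Ωf(ζ) = 0` then
`η·∇f(ζ) = (‖η‖/‖ζ‖)[ω_c s(η)s(ζ) + Λ(η)Λ(ζ)](ζ·∇f(ζ))
  + (‖η‖/‖ζ‖)[ω_c s(η)Λ(ζ) − Λ(η)s(ζ)](w(ζ)·∇f(ζ))`. -/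
theorem stmt_18 (f : E3 → ℝ) (ξ η : E3)
    (hηh : hpart η ≠ 0) (hζh : hpart (ξ - η) ≠ 0)
    (hdiff : DifferentiableAt ℝ f (ξ - η))
    (haxi : fderiv ℝ f (ξ - η) (hperp (ξ - η)) = 0) :
    fderiv ℝ f (ξ - η) η
      = (‖η‖ / ‖ξ - η‖)
          * ((⟪hpart η, hpart (ξ - η)⟫ / (‖hpart η‖ * ‖hpart (ξ - η)‖))
              * sfun η * sfun (ξ - η) + Lam η * Lam (ξ - η))
          * fderiv ℝ f (ξ - η) (ξ - η)
        + (‖η‖ / ‖ξ - η‖)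
          * ((⟪hpart η, hpart (ξ - η)⟫ / (‖hpart η‖ * ‖hpart (ξ - η)‖))
              * sfun η * Lam (ξ - η) - Lam η * sfun (ξ - η))
          * fderiv ℝ f (ξ - η) (wvec (ξ - η)) := by
  set ζ := ξ - η
  set D := fderiv ℝ f ζ
  have hη : 0 < ‖η‖ := norm_pos_of_hpart_ne_zero hηh
  have hζ : 0 < ‖ζ‖ := norm_pos_of_hpart_ne_zero hζh
  have hη' : 0 < ‖hpart η‖ := norm_pos_iff.mpr hηh
  have hζ' : 0 < ‖hpart ζ‖ := norm_pos_iff.mpr hζh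
  have hDη : D η = D (hpart η) + η 2 * D e₃ := by
    conv_lhs => rw [eq_hpart_add_smul_e₃ η]
    simp
  have hDζ : D ζ = D (hpart ζ) + ζ 2 * D e₃ := by
    conv_lhs => rw [eq_hpart_add_smul_e₃ ζ]
    simp
  have hDw : D (wvec ζ) = ζ 2 / ‖hpart ζ‖ * D (hpart ζ) - ‖hpart ζ‖ * D e₃ := by
    simp [wvec_eq hζh]
  have hDh : D (hpart η) = ⟪hpart η, hpart ζ⟫ / ‖hpart ζ‖ ^ 2 * D (hpart ζ) := by
    have h := congrArg D (norm_hpart_sq_smul_hpart η ζ)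
    simp only [map_add, map_smul, smul_eq_mul, haxi, mul_zero, add_zero] at h
    field_simp
    linarith
  rw [hDη, hDh, hDζ, hDw, sfun_eq_div hηh, sfun_eq_div hζh, Lam, Lam]
  have hsq := norm_sq_eq_norm_hpart_sq_add ζ
  generalize ⟪hpart η, hpart ζ⟫ = p
  field_simp
  rw [hsq]
  ring
end
end
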